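/- arXiv:1808.01633 — 2 statements merged into one kernel-verified Lean document; each statement's English description precedes it below -/
import Mathlib

section
/- Let O ∈ ℝ^{n_o×n_x} with Oᵀ O invertible (i.e., O has full column rank n_x), and let R ∈ ℝ^{n_x×n_x} be invertible. For k ∈ {0,…,n_ψ}, let A_k ∈ ℝ^{n_x×n_x}, B_k ∈ ℝ^{n_x×n_u}, C_k ∈ ℝ^{n_y×n_x} be arbitrary, and define the sub-Hankel matrices H := O R, H_k := O A_k R, H_{·,k} := O B_k, H_{k,·} := C_k R. Then Hᵀ H is invertible, and with the left pseudo-inverse H† := (Hᵀ H)^{-1} Hᵀ, the realized matrices Â_k := H† H_k, B̂_k := H† H_{·,k}, Ĉ_k := H_{k,·} satisfy, with the invertible matrix T := R^{-1}: Â_k T = T A_k (i.e., Â_k = R^{-1} A_k R), B̂_k = T B_k (i.e., B̂_k = R^{-1} B_k), and Ĉ_k T = C_k (i.e., Ĉ_k = C_k R), for all k ∈ {0,…,n_ψ}. Hence the realized matrices define an LPV-SS representation isomorphic to the one given by {A_k, B_k, C_k}. -/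
open Matrix

/-- the basis-reduced Ho-Kalman realization via the left pseudo-inverse
`H† = (HᵀH)⁻¹Hᵀ` of the sub-Hankel matrix `H = O R` recovers the system matrices up to
the state-space isomorphism `T = R⁻¹`. -/
theorem hoKalman_basis_reduced_realization {no nx nu ny nψ : ℕ}
    (O : Matrix (Fin no) (Fin nx) ℝ) (R : Matrix (Fin nx) (Fin nx) ℝ)
    (hO : IsUnit (Oᵀ * O)) (hR : IsUnit R)
    (A : Fin (nψ + 1) → Matrix (Fin nx) (Fin nx) ℝ)
    (B : Fin (nψ + 1) → Matrix (Fin nx) (Fin nu) ℝ)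
    (C : Fin (nψ + 1) → Matrix (Fin ny) (Fin nx) ℝ) :
    IsUnit ((O * R)ᵀ * (O * R)) ∧
    IsUnit R⁻¹ ∧
    ∀ k : Fin (nψ + 1),
      ((((O * R)ᵀ * (O * R))⁻¹ * (O * R)ᵀ) * (O * A k * R)) * R⁻¹ = R⁻¹ * A k ∧
      (((O * R)ᵀ * (O * R))⁻¹ * (O * R)ᵀ) * (O * A k * R) = R⁻¹ * A k * R ∧
      (((O * R)ᵀ * (O * R))⁻¹ * (O * R)ᵀ) * (O * B k) = R⁻¹ * B k ∧
      (C k * R) * R⁻¹ = C k := by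
  have hd : IsUnit R.det := (Matrix.isUnit_iff_isUnit_det R).1 hR
  have hT : IsUnit Rᵀ := by
    rw [Matrix.isUnit_iff_isUnit_det, Matrix.det_transpose]
    exact hd
  have hH : IsUnit ((O * R)ᵀ * (O * R)) := by
    have e : (O * R)ᵀ * (O * R) = Rᵀ * (Oᵀ * O) * R := by
      simp only [Matrix.transpose_mul, Matrix.mul_assoc]
    rw [e]
    exact (hT.mul hO).mul hR
  have hHd := (Matrix.isUnit_iff_isUnit_det _).1 hH
  have hP : (((O * R)ᵀ * (O * R))⁻¹ * (O * R)ᵀ) * O = R⁻¹ := by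
    have h1 : ((((O * R)ᵀ * (O * R))⁻¹ * (O * R)ᵀ) * O) * R = 1 := by
      rw [Matrix.mul_assoc, Matrix.mul_assoc]
      exact Matrix.nonsing_inv_mul _ hHd
    exact (Matrix.inv_eq_left_inv h1).symm
  have hA : ∀ k, (((O * R)ᵀ * (O * R))⁻¹ * (O * R)ᵀ) * (O * A k * R) = R⁻¹ * A k * R := by
    intro k
    rw [← Matrix.mul_assoc, ← Matrix.mul_assoc, hP]
  refine ⟨hH, (Matrix.isUnit_nonsing_inv_iff).2 hR, fun k => ⟨?_, hA k, ?_, ?_⟩⟩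
  · rw [hA k, Matrix.mul_nonsing_inv_cancel_right _ _ hd]
  · rw [← Matrix.mul_assoc, hP]
  · exact Matrix.mul_nonsing_inv_cancel_right _ _ hd
end

section
/- Let U ∈ ℝ^{n_o×n_x} with Uᵀ U = I, V ∈ ℝ^{n_r×n_x} with Vᵀ V = I, and Σ ∈ ℝ^{n_x×n_x} diagonal with strictly positive diagonal entries, and denote by Σ^{-1/2} the diagonal matrix with entries equal to the reciprocal square roots of those of Σ. Let O ∈ ℝ^{n_o×n_x} and R ∈ ℝ^{n_x×n_r} satisfy O R = U Σ Vᵀ. Define T₁ := Σ^{-1/2} Uᵀ O and T₂ := R V Σ^{-1/2}. Then T₁ T₂ = I, so T₁ is invertible with T₁^{-1} = T₂; and for any matrices A_k ∈ ℝ^{n_x×n_x}, B_k ∈ ℝ^{n_x×n_u}, C_k ∈ ℝ^{n_y×n_x}, the SVD-based realized matrices Â_k := Σ^{-1/2} Uᵀ (O A_k R) V Σ^{-1/2}, B̂_k := Σ^{-1/2} Uᵀ (O B_k), Ĉ_k := (C_k R) V Σ^{-1/2} satisfy Â_k = T₁ A_k T₁^{-1}, B̂_k = T₁ B_k, Ĉ_k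 = C_k T₁^{-1}. Hence the SVD-based basis-reduced Ho-Kalman realization produces an LPV-SS representation isomorphic to the one given by {A_k, B_k, C_k}. -/
open Matrix

/-- the SVD-based basis-reduced Ho-Kalman realization. With an economical SVD
`O R = U Σ Vᵀ` of the sub-Hankel matrix, the maps `T₁ = Σ^{-1/2}UᵀO` and `T₂ = R V Σ^{-1/2}`
are mutually inverse, and the realized matrices are similar to the original ones via `T₁`. -/
theorem hoKalman_svd_realization {no nr nx nu ny nψ : ℕ}
    (U : Matrix (Fin no) (Fin nx) ℝ) (V : Matrix (Fin nr) (Fin nx) ℝ)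
    (d : Fin nx → ℝ) (hd : ∀ i, 0 < d i)
    (hU : Uᵀ * U = 1) (hV : Vᵀ * V = 1)
    (O : Matrix (Fin no) (Fin nx) ℝ) (R : Matrix (Fin nx) (Fin nr) ℝ)
    (hSVD : O * R = U * Matrix.diagonal d * Vᵀ)
    (A : Fin (nψ + 1) → Matrix (Fin nx) (Fin nx) ℝ)
    (B : Fin (nψ + 1) → Matrix (Fin nx) (Fin nu) ℝ)
    (C : Fin (nψ + 1) → Matrix (Fin ny) (Fin nx) ℝ) :
    (Matrix.diagonal (fun i => (Real.sqrt (d i))⁻¹) * Uᵀ * O) *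
        (R * V * Matrix.diagonal (fun i => (Real.sqrt (d i))⁻¹)) = 1 ∧
    IsUnit (Matrix.diagonal (fun i => (Real.sqrt (d i))⁻¹) * Uᵀ * O) ∧
    (Matrix.diagonal (fun i => (Real.sqrt (d i))⁻¹) * Uᵀ * O)⁻¹ =
        R * V * Matrix.diagonal (fun i => (Real.sqrt (d i))⁻¹) ∧
    ∀ k : Fin (nψ + 1),
      Matrix.diagonal (fun i => (Real.sqrt (d i))⁻¹) * Uᵀ * (O * A k * R) * V *
          Matrix.diagonal (fun i => (Real.sqrt (d i))⁻¹) =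
        (Matrix.diagonal (fun i => (Real.sqrt (d i))⁻¹) * Uᵀ * O) * A k *
          (Matrix.diagonal (fun i => (Real.sqrt (d i))⁻¹) * Uᵀ * O)⁻¹ ∧
      Matrix.diagonal (fun i => (Real.sqrt (d i))⁻¹) * Uᵀ * (O * B k) =
        (Matrix.diagonal (fun i => (Real.sqrt (d i))⁻¹) * Uᵀ * O) * B k ∧
      (C k * R) * V * Matrix.diagonal (fun i => (Real.sqrt (d i))⁻¹) =
        C k * (Matrix.diagonal (fun i => (Real.sqrt (d i))⁻¹) * Uᵀ * O)⁻¹ := by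
  have h1 : (Matrix.diagonal (fun i => (Real.sqrt (d i))⁻¹) * Uᵀ * O) *
        (R * V * Matrix.diagonal (fun i => (Real.sqrt (d i))⁻¹)) = 1 := by
    have e : (Matrix.diagonal (fun i => (Real.sqrt (d i))⁻¹) * Uᵀ * O) *
        (R * V * Matrix.diagonal (fun i => (Real.sqrt (d i))⁻¹)) =
        Matrix.diagonal (fun i => (Real.sqrt (d i))⁻¹) * (Uᵀ * (O * R) * V) *
          Matrix.diagonal (fun i => (Real.sqrt (d i))⁻¹) := by
      simp only [Matrix.mul_assoc]
    have e2 : Uᵀ * (U * Matrix.diagonal d * Vᵀ) * V =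
        (Uᵀ * U) * Matrix.diagonal d * (Vᵀ * V) := by
      simp only [Matrix.mul_assoc]
    rw [e, hSVD, e2, hU, hV, Matrix.one_mul, Matrix.mul_one, Matrix.diagonal_mul_diagonal,
      Matrix.diagonal_mul_diagonal, ← Matrix.diagonal_one]
    congr 1
    funext i
    have hs : Real.sqrt (d i) ≠ 0 := (Real.sqrt_pos.mpr (hd i)).ne'
    have hq : Real.sqrt (d i) * Real.sqrt (d i) = d i := Real.mul_self_sqrt (hd i).le
    generalize Real.sqrt (d i) = s at hs hq
    rw [← hq]
    field_simp
  have h3 := Matrix.inv_eq_right_inv h1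
  refine ⟨h1, IsUnit.of_mul_eq_one _ h1, h3, fun k => ?_⟩
  rw [h3]
  refine ⟨?_, ?_, ?_⟩ <;> simp only [Matrix.mul_assoc]
end
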